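/- Let a, b, c be complex numbers, none of which is an integer, with Re(c - a - b) > 0. Then Σ_{k=0}^∞ [(a)_k (b)_k / ((c)_k k!)] · [ψ(c+k) + ψ(1+k) - ψ(a+k) - ψ(b+k)] = π (cot(πa) + cot(πb)) · Γ(c) Γ(c-a-b) / (Γ(c-a) Γ(c-b)) - ((1-c)/((1-a)(1-b))) · Σ_{k=0}^∞ k! (2-c)_k / ((2-a)_k (2-b)_k). Both series converge absolutely. -/

import Mathlib

open Complex Finset

noncomputable def ψ (z : ℂ) : ℂ := deriv Complex.Gamma z / Complex.Gamma z

noncomputable def rf (x : ℂ) (n : ℕ) : ℂ := ∏ j ∈ Finset.range n, (x + j)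

theorem periodic_eq_const_of_norm_le {G : ℂ → ℂ} (hG : Differentiable ℂ G)
    (hper : Function.Periodic G 1) {C : ℝ}
    (hC : ∀ s, ‖G s‖ ≤ C / (1 + |s.im|) * Real.exp (2 * Real.pi * |s.im|)) (s : ℂ) :
    G s = G 0 := by
  have hper' : Function.Periodic G ((1 : ℝ) : ℂ) := by simpa using hper
  set g := Function.Periodic.cuspFunction 1 G with hg
  set m : ℂ → ℝ := fun q => C / (1 + |Real.log ‖q‖| / (2 * Real.pi)) with hm
  have hpi := Real.pi_pos
  have hgb : ∀ q : ℂ, q ≠ 0 → ‖g q‖ ≤ m q * Real.exp |Real.log ‖q‖| := by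
    intro q hq
    rw [hg, Function.Periodic.cuspFunction_eq_of_nonzero _ _ hq]
    refine (hC _).trans (le_of_eq ?_)
    have : |(Function.Periodic.invQParam 1 q).im| = |Real.log ‖q‖| / (2 * Real.pi) := by
      rw [Function.Periodic.im_invQParam, abs_mul, abs_div, abs_neg, abs_one,
        abs_of_pos (by positivity : 0 < 2 * Real.pi)]
      ring
    rw [this]
    congr 2
    field_simp
  have hm_of_tendsto : ∀ {l : Filter ℂ},
      Filter.Tendsto (fun q : ℂ => |Real.log ‖q‖|) l Filter.atTop →
      Filter.Tendsto m l (nhds 0) := by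
    intro l hl
    refine Filter.Tendsto.const_div_atTop ?_ _
    exact Filter.tendsto_atTop_add_const_left _ _ (hl.atTop_div_const (by positivity))
  have hgd : ∀ q : ℂ, q ≠ 0 → DifferentiableAt ℂ g q := by
    intro q hq
    have h1 := Function.Periodic.differentiableAt_cuspFunction one_ne_zero hper'
      (hG (Function.Periodic.invQParam 1 q))
    rwa [Function.Periodic.qParam_right_inv one_ne_zero hq] at h1
  have hm0 : Filter.Tendsto m (nhdsWithin 0 {0}ᶜ) (nhds 0) := by
    apply hm_of_tendsto
    exact Filter.tendsto_abs_atBot_atTop.comp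
      (Real.tendsto_log_nhdsGT_zero.comp tendsto_norm_nhdsNE_zero)
  have ho : g =o[nhdsWithin 0 {0}ᶜ] fun z => (z - 0)⁻¹ := by
    rw [Asymptotics.isLittleO_iff_tendsto'
      (by filter_upwards [self_mem_nhdsWithin] with q hq h; simp_all)]
    rw [tendsto_zero_iff_norm_tendsto_zero]
    refine squeeze_zero' (Filter.Eventually.of_forall fun _ => norm_nonneg _) ?_ hm0
    have h1 : ∀ᶠ q : ℂ in nhdsWithin 0 {0}ᶜ, ‖q‖ < 1 :=
      nhdsWithin_le_nhds (by
        simpa [dist_zero_right, Metric.ball] using Metric.ball_mem_nhds (0 : ℂ) one_pos)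
    filter_upwards [self_mem_nhdsWithin, h1] with q hq hq1
    have hq : q ≠ 0 := hq
    have hqp : 0 < ‖q‖ := norm_pos_iff.mpr hq
    have := hgb q hq
    rw [abs_of_neg (Real.log_neg hqp hq1), Real.exp_neg, Real.exp_log hqp] at this
    rw [sub_zero, norm_div, norm_inv, div_inv_eq_mul]
    calc ‖g q‖ * ‖q‖ ≤ m q * ‖q‖⁻¹ * ‖q‖ := by gcongr
      _ = m q := by field_simp
  have ho' : (fun q => g q - g 0) =o[nhdsWithin 0 {0}ᶜ] fun z => (z - 0)⁻¹ := by
    refine ho.sub (Asymptotics.isLittleO_const_left.mpr (Or.inr ?_))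
    simpa [Function.comp_def] using
      tendsto_norm_cobounded_atTop.comp (Filter.tendsto_inv₀_nhdsNE_zero (α := ℂ))
  have hH := Complex.differentiableOn_update_limUnder_of_isLittleO (c := 0) (s := Set.univ)
    Filter.univ_mem (fun q hq => (hgd q (by simpa using hq)).differentiableWithinAt) ho'
  set H := Function.update g 0 (Filter.limUnder (nhdsWithin 0 {0}ᶜ) g) with hHdef
  have hHg : ∀ q : ℂ, q ≠ 0 → H q = g q := fun q hq => Function.update_of_ne hq _ _
  have hD : Differentiable ℂ (dslope H 0) := by
    rw [← differentiableOn_univ]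
    exact (Complex.differentiableOn_dslope Filter.univ_mem).mpr hH
  have hinf : Filter.Tendsto (dslope H 0) (Filter.cocompact ℂ) (nhds 0) := by
    have hn := tendsto_norm_cocompact_atTop (E := ℂ)
    have hminf : Filter.Tendsto m (Filter.cocompact ℂ) (nhds 0) :=
      hm_of_tendsto (Filter.tendsto_abs_atTop_atTop.comp (Real.tendsto_log_atTop.comp hn))
    have h2 : Filter.Tendsto (fun q : ℂ => m q + ‖H 0‖ / ‖q‖) (Filter.cocompact ℂ) (nhds 0) := by
      simpa using hminf.add (hn.const_div_atTop ‖H 0‖)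
    rw [tendsto_zero_iff_norm_tendsto_zero]
    refine squeeze_zero' (Filter.Eventually.of_forall fun _ => norm_nonneg _) ?_ h2
    filter_upwards [hn.eventually_ge_atTop 1] with q hq1
    have hqp : 0 < ‖q‖ := by linarith
    have hq : q ≠ 0 := norm_pos_iff.mp hqp
    have := hgb q hq
    rw [abs_of_nonneg (Real.log_nonneg hq1), Real.exp_log hqp] at this
    rw [dslope_of_ne _ hq, slope_def_field, sub_zero, hHg q hq, norm_div, div_le_iff₀ hqp]
    calc ‖g q - H 0‖ ≤ ‖g q‖ + ‖H 0‖ := norm_sub_le _ _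
      _ ≤ m q * ‖q‖ + ‖H 0‖ := by gcongr
      _ = _ := by field_simp
  have hconst : ∀ q : ℂ, q ≠ 0 → g q = H 0 := by
    intro q hq
    have h3 := hD.apply_eq_of_tendsto_cocompact q hinf
    rw [dslope_of_ne _ hq, slope_def_field, sub_zero, div_eq_zero_iff, or_iff_left hq,
      sub_eq_zero] at h3
    rw [← hHg q hq, h3]
  have hall : ∀ z, G z = H 0 := fun z => by
    rw [← Function.Periodic.eq_cuspFunction one_ne_zero hper' z]
    exact hconst _ (Function.Periodic.qParam_ne_zero z)
  rw [hall, hall]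

noncomputable def invBeta (a c s : ℂ) : ℂ := (Gamma (1 - a - s))⁻¹ * (Gamma (c + s))⁻¹

theorem differentiable_invBeta (a c : ℂ) : Differentiable ℂ (invBeta a c) := by
  have h1 : Differentiable ℂ fun s : ℂ => (Gamma (1 - a - s))⁻¹ :=
    differentiable_one_div_Gamma.comp (by fun_prop : Differentiable ℂ fun s : ℂ => 1 - a - s)
  have h2 : Differentiable ℂ fun s : ℂ => (Gamma (c + s))⁻¹ :=
    differentiable_one_div_Gamma.comp (by fun_prop : Differentiable ℂ fun s : ℂ => c + s)
  exact h1.mul h2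

theorem invBeta_eq_mul_invBeta_add_one_right (a c s : ℂ) :
    invBeta a c s = (c + s) * invBeta a (c + 1) s := by
  unfold invBeta
  rw [one_div_Gamma_eq_self_mul_one_div_Gamma_add_one (c + s)]
  ring_nf

theorem mul_invBeta_add_one (a c s : ℂ) :
    (c + s) * invBeta a c (s + 1) = -(a + s) * invBeta a c s := by
  unfold invBeta
  have h1 := one_div_Gamma_eq_self_mul_one_div_Gamma_add_one (c + s)
  have h2 := one_div_Gamma_eq_self_mul_one_div_Gamma_add_one (1 - a - (s + 1))
  rw [h1, h2]
  ring_nf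

theorem invBeta_neg (a c s : ℂ) : invBeta (1 - c) (1 - a) (-s) = invBeta a c s := by
  unfold invBeta
  rw [mul_comm]
  ring_nf

theorem norm_sin_le_exp (z : ℂ) : ‖sin z‖ ≤ Real.exp |z.im| := by
  have h : ‖cexp (-z * I) - cexp (z * I)‖ ≤ Real.exp |z.im| + Real.exp |z.im| := by
    refine (norm_sub_le _ _).trans (add_le_add ?_ ?_) <;> rw [norm_exp, Real.exp_le_exp] <;> simp
    · exact le_abs_self _
    · exact neg_le_abs _
  rw [sin, norm_div, norm_mul, norm_I]
  simp only [Complex.norm_ofNat]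
  linarith

theorem norm_betaIntegral_le {u v : ℂ} (hu : 1 ≤ u.re) (hv : 0 < v.re) :
    ‖betaIntegral u v‖ ≤ ∫ x in (0 : ℝ)..1, (1 - x) ^ (v.re - 1) := by
  have hint : IntervalIntegrable (fun x : ℝ => (1 - x) ^ (v.re - 1)) MeasureTheory.volume 0 1 := by
    have := (intervalIntegral.intervalIntegrable_rpow' (a := 0) (b := 1)
      (by linarith : -1 < v.re - 1)).comp_sub_left 1
    simpa using this.symm
  refine intervalIntegral.norm_integral_le_of_norm_le zero_le_one ?_ hint
  filter_upwards [MeasureTheory.compl_mem_ae_iff.mpr (MeasureTheory.measure_singleton (1 : ℝ))]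
    with x hx1 hx
  have hx1 : x < 1 := lt_of_le_of_ne hx.2 hx1
  have h1 : ((1 : ℂ) - x) = ((1 - x : ℝ) : ℂ) := by push_cast; rfl
  rw [norm_mul, norm_cpow_eq_rpow_re_of_pos hx.1, h1, norm_cpow_eq_rpow_re_of_pos (by linarith)]
  have := Real.rpow_le_one hx.1.le hx1.le (by simpa using hu : 0 ≤ (u - 1).re)
  simpa using mul_le_mul_of_nonneg_right this (Real.rpow_nonneg (by linarith) (v - 1).re)

theorem exists_norm_invBeta_le_of_one_le_re {a c : ℂ} (h : 0 < (c - a).re) :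
    ∃ C, ∀ s, 1 ≤ (a + s).re → ‖invBeta a c s‖ ≤ C * Real.exp (Real.pi * |s.im|) := by
  refine ⟨Real.pi⁻¹ * Real.exp (Real.pi * |a.im|) *
    ((∫ x in (0 : ℝ)..1, (1 - x) ^ ((c - a).re - 1)) * ‖Gamma (c - a)‖⁻¹), fun s hs => ?_⟩
  have hpi := Real.pi_pos
  have hpos : 0 < (a + s).re := by linarith
  have h1 := Gamma_mul_Gamma_eq_betaIntegral hpos h
  have h2 := Gamma_mul_Gamma_one_sub (a + s)
  have h3 : Gamma (c - a) ≠ 0 := Gamma_ne_zero_of_re_pos h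
  have h4 : Gamma (a + s) ≠ 0 := Gamma_ne_zero_of_re_pos hpos
  have h5 : Gamma (c + s) ≠ 0 := Gamma_ne_zero_of_re_pos (by simp at *; linarith)
  have hpc : (Real.pi : ℂ) ≠ 0 := by exact_mod_cast hpi.ne'
  have key : invBeta a c s =
      (Real.pi : ℂ)⁻¹ * sin (Real.pi * (a + s)) *
        (betaIntegral (a + s) (c - a) * (Gamma (c - a))⁻¹) := by
    unfold invBeta
    have e1 : a + s + (c - a) = c + s := by ring
    rw [e1] at h1
    have e2 : 1 - a - s = 1 - (a + s) := by ring
    have h6 : betaIntegral (a + s) (c - a) * (Gamma (c - a))⁻¹ =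
        Gamma (a + s) * (Gamma (c + s))⁻¹ := by
      field_simp
      linear_combination -h1
    have h7 : (Gamma (1 - a - s))⁻¹ =
        (Real.pi : ℂ)⁻¹ * sin (Real.pi * (a + s)) * Gamma (a + s) := by
      have h8 : Gamma (1 - a - s) = Real.pi / sin (Real.pi * (a + s)) * (Gamma (a + s))⁻¹ := by
        rw [e2, ← h2]; field_simp
      rw [h8, mul_inv, inv_div, inv_inv, div_eq_mul_inv]
      ring
    rw [h6, h7]
    ring
  rw [key, norm_mul, norm_mul, norm_mul, norm_inv, norm_inv, norm_real, Real.norm_of_nonneg hpi.le]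
  have hsin : ‖sin (Real.pi * (a + s))‖ ≤
      Real.exp (Real.pi * |a.im|) * Real.exp (Real.pi * |s.im|) := by
    refine (norm_sin_le_exp _).trans ?_
    rw [← Real.exp_add, Real.exp_le_exp]
    simp only [mul_im, ofReal_re, ofReal_im, zero_mul, add_zero, add_im, abs_mul, abs_of_pos hpi]
    rw [← mul_add]
    gcongr
    exact abs_add_le _ _
  have hb := norm_betaIntegral_le hs h
  calc Real.pi⁻¹ * ‖sin (Real.pi * (a + s))‖ * (‖betaIntegral (a + s) (c - a)‖ * ‖Gamma (c - a)‖⁻¹)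
      ≤ Real.pi⁻¹ * (Real.exp (Real.pi * |a.im|) * Real.exp (Real.pi * |s.im|)) *
        ((∫ x in (0 : ℝ)..1, (1 - x) ^ ((c - a).re - 1)) * ‖Gamma (c - a)‖⁻¹) := by gcongr
    _ = _ := by ring

theorem exists_norm_le_of_norm_add_le_one {f : ℂ → ℝ} (hf : Continuous f) (w : ℂ) :
    ∃ K, 0 ≤ K ∧ ∀ s, ‖w + s‖ ≤ 1 → f s ≤ K := by
  obtain ⟨K, hK⟩ := (isCompact_closedBall (-w) 1).exists_bound_of_continuousOn hf.continuousOn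
  refine ⟨max K 0, le_max_right _ _, fun s hs => ?_⟩
  refine (le_abs_self _).trans ((hK s ?_).trans (le_max_left _ _))
  rw [Metric.mem_closedBall, dist_eq_norm]
  rwa [sub_neg_eq_add, add_comm]

theorem one_le_exp_pi_mul_abs (s : ℂ) : 1 ≤ Real.exp (Real.pi * |s.im|) :=
  Real.one_le_exp (by have := Real.pi_pos; positivity)

theorem exists_norm_invBeta_le_of_sub_le_re {a c : ℂ} (h : 0 < (c - a).re) (n : ℕ) :
    ∃ C, ∀ s, 1 - (n : ℝ) ≤ (a + s).re → ‖invBeta a c s‖ ≤ C * Real.exp (Real.pi * |s.im|) := by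
  induction n with
  | zero => simpa using exists_norm_invBeta_le_of_one_le_re h
  | succ n ih =>
    obtain ⟨C, hC⟩ := ih
    obtain ⟨K, hK0, hK⟩ := exists_norm_le_of_norm_add_le_one
      (differentiable_invBeta a c).continuous.norm a
    refine ⟨max K ((1 + ‖c - a‖) * C), fun s hs => ?_⟩
    rcases le_total ‖a + s‖ 1 with h1 | h1
    · calc ‖invBeta a c s‖ ≤ K := hK s h1
        _ ≤ K * Real.exp (Real.pi * |s.im|) := le_mul_of_one_le_right hK0 (one_le_exp_pi_mul_abs s)
        _ ≤ _ := by gcongr; exact le_max_left _ _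
    · have hpos : 0 < ‖a + s‖ := by linarith
      have h2 := congrArg norm (mul_invBeta_add_one a c s)
      rw [norm_mul, norm_mul, norm_neg] at h2
      have h3 := hC (s + 1) (by push_cast at hs; simp at hs ⊢; linarith)
      have h4 : (s + 1).im = s.im := by simp
      rw [h4] at h3
      have h5 : ‖c + s‖ ≤ (1 + ‖c - a‖) * ‖a + s‖ := by
        calc ‖c + s‖ = ‖(a + s) + (c - a)‖ := by ring_nf
          _ ≤ ‖a + s‖ + ‖c - a‖ := norm_add_le _ _
          _ ≤ _ := by nlinarith [norm_nonneg (c - a)]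
      have h6 : ‖invBeta a c s‖ * ‖a + s‖ ≤
          ((1 + ‖c - a‖) * C * Real.exp (Real.pi * |s.im|)) * ‖a + s‖ := by
        calc ‖invBeta a c s‖ * ‖a + s‖ = ‖c + s‖ * ‖invBeta a c (s + 1)‖ := by rw [h2]; ring
          _ ≤ ((1 + ‖c - a‖) * ‖a + s‖) * (C * Real.exp (Real.pi * |s.im|)) := by gcongr
          _ = _ := by ring
      refine (le_of_mul_le_mul_right h6 hpos).trans ?_
      gcongr
      exact le_max_right _ _

theorem exists_norm_invBeta_le {a c : ℂ} (h : 0 < (c - a).re) :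
    ∃ C, ∀ s, ‖invBeta a c s‖ ≤ C * Real.exp (Real.pi * |s.im|) := by
  obtain ⟨n, hn⟩ := exists_nat_ge (1 + c.re - a.re)
  obtain ⟨C, hC⟩ := exists_norm_invBeta_le_of_sub_le_re h n
  have h' : 0 < ((1 - a) - (1 - c)).re := by convert h using 2; ring
  obtain ⟨D, hD⟩ := exists_norm_invBeta_le_of_one_le_re h'
  refine ⟨max C D, fun s => ?_⟩
  rcases le_total (1 - (n : ℝ)) (a + s).re with h1 | h1
  · refine (hC s h1).trans ?_
    gcongr
    exact le_max_left _ _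
  · have := hD (-s) (by simp at h1 ⊢; linarith)
    rw [invBeta_neg] at this
    simp only [neg_im, abs_neg] at this
    refine this.trans ?_
    gcongr
    exact le_max_right _ _

theorem exists_norm_invBeta_le_mul_pow (N : ℕ) {a c : ℂ} (h : -(N : ℝ) < (c - a).re) :
    ∃ C, 0 ≤ C ∧
      ∀ s, ‖invBeta a c s‖ ≤ C * (1 + ‖s‖) ^ N * Real.exp (Real.pi * |s.im|) := by
  induction N generalizing c with
  | zero =>
    obtain ⟨C, hC⟩ := exists_norm_invBeta_le (by simpa using h)
    refine ⟨C, ?_, by simpa using hC⟩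
    have := (norm_nonneg _).trans (hC 0)
    simpa using this
  | succ N ih =>
    obtain ⟨C, hC0, hC⟩ := ih (c := c + 1) (by push_cast at h; simp at h ⊢; linarith)
    refine ⟨(‖c‖ + 1) * C, by positivity, fun s => ?_⟩
    rw [invBeta_eq_mul_invBeta_add_one_right, norm_mul]
    have h1 : ‖c + s‖ ≤ (‖c‖ + 1) * (1 + ‖s‖) := by
      nlinarith [norm_add_le c s, norm_nonneg c, norm_nonneg s,
        mul_nonneg (norm_nonneg c) (norm_nonneg s)]
    calc _ ≤ ((‖c‖ + 1) * (1 + ‖s‖)) * (C * (1 + ‖s‖) ^ N * Real.exp (Real.pi * |s.im|)) := by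
          gcongr; exact hC s
      _ = _ := by ring

theorem exists_norm_invBeta_mul_pow_le (M : ℕ) {a c : ℂ} (h : (M : ℝ) < (c - a).re) :
    ∃ C, 0 ≤ C ∧
      ∀ s, ‖invBeta a c s‖ * (1 + ‖s‖) ^ M ≤ C * Real.exp (Real.pi * |s.im|) := by
  induction M generalizing c with
  | zero =>
    obtain ⟨C, hC⟩ := exists_norm_invBeta_le (by simpa using h)
    refine ⟨C, ?_, by simpa using hC⟩
    have := (norm_nonneg _).trans (hC 0)
    simpa using this
  | succ M ih =>
    obtain ⟨C, hC0, hC⟩ := ih (c := c - 1) (by push_cast at h; simp at h ⊢; linarith)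
    have hcont := (differentiable_invBeta a c).continuous
    obtain ⟨K, hK0, hK⟩ := exists_norm_le_of_norm_add_le_one
      (by fun_prop : Continuous fun s => ‖invBeta a c s‖ * (1 + ‖s‖) ^ (M + 1)) (c - 1)
    refine ⟨max K ((2 + ‖c - 1‖) * C), le_max_of_le_left hK0, fun s => ?_⟩
    rcases le_total ‖c - 1 + s‖ 1 with h1 | h1
    · calc _ ≤ K := hK s h1
        _ ≤ K * Real.exp (Real.pi * |s.im|) := le_mul_of_one_le_right hK0 (one_le_exp_pi_mul_abs s)
        _ ≤ _ := by gcongr; exact le_max_left _ _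
    · have h2 := invBeta_eq_mul_invBeta_add_one_right a (c - 1) s
      rw [sub_add_cancel] at h2
      have h3 : 1 + ‖s‖ ≤ (2 + ‖c - 1‖) * ‖c - 1 + s‖ := by
        have : ‖s‖ ≤ ‖c - 1 + s‖ + ‖c - 1‖ := by
          calc ‖s‖ = ‖(c - 1 + s) - (c - 1)‖ := by ring_nf
            _ ≤ _ := norm_sub_le _ _
        nlinarith [norm_nonneg (c - 1)]
      calc ‖invBeta a c s‖ * (1 + ‖s‖) ^ (M + 1)
          = ‖invBeta a c s‖ * (1 + ‖s‖) ^ M * (1 + ‖s‖) := by ring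
        _ ≤ ‖invBeta a c s‖ * (1 + ‖s‖) ^ M * ((2 + ‖c - 1‖) * ‖c - 1 + s‖) := by gcongr
        _ = (2 + ‖c - 1‖) * (‖invBeta a (c - 1) s‖ * (1 + ‖s‖) ^ M) := by
          rw [h2, norm_mul]; ring
        _ ≤ (2 + ‖c - 1‖) * (C * Real.exp (Real.pi * |s.im|)) := by
          exact mul_le_mul_of_nonneg_left (hC s) (by positivity)
        _ ≤ _ := by rw [← mul_assoc]; gcongr; exact le_max_right _ _

theorem summable_one_div_one_add_abs_int_sq :
    Summable fun k : ℤ => 1 / (1 + |(k : ℝ)|) ^ 2 := by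
  have h1 : Summable fun k : ℤ => 1 / (k : ℝ) ^ 2 + if k = 0 then 1 else 0 :=
    (Real.summable_one_div_int_pow.mpr one_lt_two).add (hasSum_ite_eq 0 1).summable
  refine Summable.of_nonneg_of_le (fun k => by positivity) (fun k => ?_) h1
  rcases eq_or_ne k 0 with rfl | hk
  · simp
  · have : (0 : ℝ) < |(k : ℝ)| := abs_pos.mpr (by exact_mod_cast hk)
    rw [if_neg hk, add_zero, ← sq_abs (k : ℝ)]
    gcongr
    linarith

theorem hasSum_deriv_int_eq_zero {E : ℂ → ℂ} (hE : Differentiable ℂ E) {C : ℝ} (hC0 : 0 ≤ C)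
    (hC : ∀ s, ‖E s‖ * (1 + ‖s‖) ^ 3 ≤ C * Real.exp (2 * Real.pi * |s.im|)) :
    HasSum (fun k : ℤ => deriv E k) 0 := by
  set G : ℂ → ℂ := fun s => ∑' k : ℤ, E (s + k) with hGdef
  have hpi := Real.pi_pos
  have hsum := summable_one_div_one_add_abs_int_sq
  have hdiv : ∀ s, ‖E s‖ ≤ C * Real.exp (2 * Real.pi * |s.im|) / (1 + ‖s‖) ^ 3 := fun s => by
    rw [le_div_iff₀ (by positivity)]
    exact hC s
  have him : ∀ (s : ℂ) (k : ℤ), (s + k).im = s.im := fun s k => by simp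
  have hloc : ∀ (R : ℝ) (k : ℤ) (s : ℂ), s ∈ Metric.ball (0 : ℂ) R →
      ‖E (s + k)‖ ≤ C * Real.exp (2 * Real.pi * R) * (1 + R) ^ 2 * (1 / (1 + |(k : ℝ)|) ^ 2) := by
    intro R k s hs
    have hs : ‖s‖ < R := by simpa using hs
    have hR : 0 ≤ R := (norm_nonneg s).trans hs.le
    have h1 : 1 + |(k : ℝ)| ≤ (1 + R) * (1 + ‖s + k‖) := by
      have : |(k : ℝ)| ≤ ‖s + k‖ + ‖s‖ := by
        calc |(k : ℝ)| = ‖(s + k) - s‖ := by simp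
          _ ≤ _ := norm_sub_le _ _
      nlinarith [norm_nonneg (s + k)]
    have h2 : 1 / (1 + ‖s + k‖) ^ 2 ≤ (1 + R) ^ 2 * (1 / (1 + |(k : ℝ)|) ^ 2) := by
      rw [mul_one_div, div_le_div_iff₀ (by positivity) (by positivity), one_mul, ← mul_pow]
      gcongr
    calc ‖E (s + k)‖ ≤ C * Real.exp (2 * Real.pi * |(s + k).im|) / (1 + ‖s + k‖) ^ 3 := hdiv _
      _ ≤ C * Real.exp (2 * Real.pi * R) / (1 + ‖s + k‖) ^ 2 := by
        rw [him]
        gcongr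
        · exact (abs_im_le_norm s).trans hs.le
        · linarith [norm_nonneg (s + k)]
        · norm_num
      _ = C * Real.exp (2 * Real.pi * R) * (1 / (1 + ‖s + k‖) ^ 2) := by ring
      _ ≤ C * Real.exp (2 * Real.pi * R) * ((1 + R) ^ 2 * (1 / (1 + |(k : ℝ)|) ^ 2)) := by gcongr
      _ = _ := by ring
  have hdiff : ∀ (R : ℝ) (k : ℤ), DifferentiableOn ℂ (fun s => E (s + k)) (Metric.ball 0 R) :=
    fun R k => (hE.comp (by fun_prop : Differentiable ℂ fun s : ℂ => s + k)).differentiableOn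
  have hG : Differentiable ℂ G := by
    intro s
    have hs : s ∈ Metric.ball (0 : ℂ) (‖s‖ + 1) := by simp
    exact (differentiableOn_tsum_of_summable_norm (hsum.mul_left _) (hdiff _) Metric.isOpen_ball
      (hloc _)).differentiableAt (Metric.isOpen_ball.mem_nhds hs)
  have hper : Function.Periodic G 1 := by
    intro s
    rw [hGdef]
    simp only
    rw [← (Equiv.addRight (1 : ℤ)).tsum_eq (fun k : ℤ => E (s + k))]
    refine tsum_congr fun k => congrArg E ?_
    simp only [Equiv.coe_addRight]
    push_cast
    ring
  have hstrip : ∀ s : ℂ, |s.re| ≤ 1 → ‖G s‖ ≤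
      (∑' k : ℤ, 4 * C * (1 / (1 + |(k : ℝ)|) ^ 2)) / (1 + |s.im|) *
        Real.exp (2 * Real.pi * |s.im|) := by
    intro s hs
    have hterm : ∀ k : ℤ, ‖E (s + k)‖ ≤ 4 * C * (1 / (1 + |(k : ℝ)|) ^ 2) *
        ((1 / (1 + |s.im|)) * Real.exp (2 * Real.pi * |s.im|)) := by
      intro k
      have h1 : 1 + |(k : ℝ)| ≤ 2 * (1 + ‖s + k‖) := by
        have h3 : |(k : ℝ)| ≤ |(s + k).re| + |s.re| := by
          calc |(k : ℝ)| = |(s + k).re - s.re| := by simp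
            _ ≤ _ := abs_sub _ _
        linarith [abs_re_le_norm (s + k), norm_nonneg (s + k)]
      have h2 : 1 / (1 + ‖s + k‖) ^ 2 ≤ 4 * (1 / (1 + |(k : ℝ)|) ^ 2) := by
        rw [mul_one_div, div_le_div_iff₀ (by positivity) (by positivity), one_mul]
        calc (1 + |(k : ℝ)|) ^ 2 ≤ (2 * (1 + ‖s + k‖)) ^ 2 := by gcongr
          _ = _ := by ring
      have h3 : |s.im| ≤ ‖s + k‖ := by simpa using abs_im_le_norm (s + k)
      calc ‖E (s + k)‖ ≤ C * Real.exp (2 * Real.pi * |(s + k).im|) / (1 + ‖s + k‖) ^ 3 := hdiv _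
        _ = C * Real.exp (2 * Real.pi * |s.im|) *
            ((1 / (1 + ‖s + k‖) ^ 2) * (1 / (1 + ‖s + k‖))) := by rw [him]; field_simp
        _ ≤ C * Real.exp (2 * Real.pi * |s.im|) *
            ((4 * (1 / (1 + |(k : ℝ)|) ^ 2)) * (1 / (1 + |s.im|))) := by gcongr
        _ = _ := by ring
    calc ‖G s‖ ≤ ∑' k : ℤ, 4 * C * (1 / (1 + |(k : ℝ)|) ^ 2) *
        ((1 / (1 + |s.im|)) * Real.exp (2 * Real.pi * |s.im|)) :=
          tsum_of_norm_bounded ((hsum.mul_left _).mul_right _).hasSum hterm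
      _ = _ := by rw [tsum_mul_right]; ring
  have hbound : ∀ s : ℂ, ‖G s‖ ≤
      (∑' k : ℤ, 4 * C * (1 / (1 + |(k : ℝ)|) ^ 2)) / (1 + |s.im|) *
        Real.exp (2 * Real.pi * |s.im|) := by
    intro s
    have h1 := hstrip (s - ⌊s.re⌋) (by
      simp only [sub_re, intCast_re]
      rw [abs_of_nonneg (by linarith [Int.floor_le s.re])]
      linarith [Int.lt_floor_add_one s.re])
    have h2 : G (s - ⌊s.re⌋) = G s := by simpa using hper.sub_zsmul_eq ⌊s.re⌋ (x := s)
    rw [h2] at h1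
    simpa using h1
  have hconst : G = fun _ => G 0 :=
    funext fun s => periodic_eq_const_of_norm_le hG hper hbound s
  have hmain := hasSum_deriv_of_summable_norm (hsum.mul_left _) (hdiff 1) Metric.isOpen_ball
    (hloc 1) (Metric.mem_ball_self one_pos)
  have h0 : deriv G 0 = 0 := by rw [hconst]; simp
  rw [hGdef] at h0
  rw [h0] at hmain
  simpa [deriv_comp_add_const] using hmain

noncomputable def bilateralTerm (a b c s : ℂ) : ℂ := invBeta a c s * invBeta b 1 s

theorem differentiable_bilateralTerm (a b c : ℂ) : Differentiable ℂ (bilateralTerm a b c) :=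
  (differentiable_invBeta a c).mul (differentiable_invBeta b 1)

theorem hasSum_deriv_bilateralTerm_of_large {a b c : ℂ} {N : ℕ} (hb : -(N : ℝ) < (1 - b).re)
    (hc : (N : ℝ) + 3 < (c - a).re) :
    HasSum (fun k : ℤ => deriv (bilateralTerm a b c) k) 0 := by
  obtain ⟨C, hC0, hC⟩ := exists_norm_invBeta_mul_pow_le (N + 3) (by push_cast; exact hc)
  obtain ⟨D, hD0, hD⟩ := exists_norm_invBeta_le_mul_pow N hb
  refine hasSum_deriv_int_eq_zero (C := C * D) (differentiable_bilateralTerm a b c)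
    (by positivity) fun s => ?_
  have hpos : 0 < (1 + ‖s‖) ^ N := by positivity
  refine le_of_mul_le_mul_right ?_ hpos
  calc ‖bilateralTerm a b c s‖ * (1 + ‖s‖) ^ 3 * (1 + ‖s‖) ^ N
      = (‖invBeta a c s‖ * (1 + ‖s‖) ^ (N + 3)) * ‖invBeta b 1 s‖ := by
        rw [bilateralTerm, norm_mul]; ring
    _ ≤ (C * Real.exp (Real.pi * |s.im|)) *
        (D * (1 + ‖s‖) ^ N * Real.exp (Real.pi * |s.im|)) :=
        mul_le_mul (hC s) (hD s) (norm_nonneg _) (by positivity)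
    _ = C * D * (Real.exp (Real.pi * |s.im|) * Real.exp (Real.pi * |s.im|)) * (1 + ‖s‖) ^ N := by
        ring
    _ = C * D * Real.exp (2 * Real.pi * |s.im|) * (1 + ‖s‖) ^ N := by
        rw [← Real.exp_add]; ring_nf

theorem rf_zero (x : ℂ) : rf x 0 = 1 := by simp [rf]

theorem rf_succ (x : ℂ) (n : ℕ) : rf x (n + 1) = rf x n * (x + n) := prod_range_succ _ _

theorem rf_succ_left (x : ℂ) (n : ℕ) : rf x (n + 1) = x * rf (x + 1) n := by
  unfold rf
  rw [prod_range_succ']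
  simp only [Nat.cast_zero, add_zero, mul_comm x]
  congr 1
  refine prod_congr rfl fun j _ => ?_
  push_cast
  ring

theorem rf_one (n : ℕ) : rf 1 n = (n.factorial : ℂ) := by
  induction n with
  | zero => simp [rf]
  | succ n ih => rw [rf_succ, ih, Nat.factorial_succ]; push_cast; ring

theorem rf_ne_zero {x : ℂ} (hx : ∀ m : ℕ, x ≠ -m) (n : ℕ) : rf x n ≠ 0 :=
  prod_ne_zero_iff.mpr fun j _ h => hx j (eq_neg_of_add_eq_zero_left h)

theorem rf_succ_eq_GammaSeq (x : ℂ) {n : ℕ} (hn : n ≠ 0) :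
    rf x (n + 1) = (n : ℂ) ^ x * n.factorial * (GammaSeq x n)⁻¹ := by
  have h1 : (n : ℂ) ^ x ≠ 0 := by simp [cpow_eq_zero_iff, hn]
  have h2 : (n.factorial : ℂ) ≠ 0 := by exact_mod_cast n.factorial_ne_zero
  rw [GammaSeq, inv_div, rf]
  field_simp

theorem tendsto_inv_GammaSeq (x : ℂ) :
    Filter.Tendsto (fun n => (GammaSeq x n)⁻¹) Filter.atTop (nhds (Gamma x)⁻¹) := by
  by_cases hx : ∀ m : ℕ, x ≠ -m
  · exact (GammaSeq_tendsto_Gamma x).inv₀ (Gamma_ne_zero hx)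
  · push Not at hx
    obtain ⟨m, rfl⟩ := hx
    rw [Gamma_neg_nat_eq_zero, inv_zero]
    refine tendsto_const_nhds.congr' ?_
    filter_upwards [Filter.eventually_ge_atTop m] with n hn
    have : ∏ j ∈ range (n + 1), (-(m : ℂ) + j) = 0 :=
      prod_eq_zero (mem_range.mpr (Nat.lt_succ_of_le hn)) (by simp)
    rw [GammaSeq, this, div_zero, inv_zero]

noncomputable def hgCoeff (a b c d : ℂ) (k : ℕ) : ℂ := rf a k * rf b k / (rf c k * rf d k)

theorem hgCoeff_succ (a b c d : ℂ) (k : ℕ) :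
    hgCoeff a b c d (k + 1) = hgCoeff a b c d k * ((a + k) * (b + k) / ((c + k) * (d + k))) := by
  unfold hgCoeff
  simp only [rf_succ]
  rw [div_mul_div_comm]
  ring

theorem hgCoeff_succ_isBigO {a b : ℂ} (ha : ∀ m : ℕ, a ≠ -m) (hb : ∀ m : ℕ, b ≠ -m) (c d : ℂ) :
    (fun k => hgCoeff a b c d (k + 1)) =O[Filter.atTop]
      fun k : ℕ => (k : ℝ) ^ (a + b - c - d).re := by
  have h1 : Filter.Tendsto
      (fun k => (GammaSeq a k)⁻¹ * (GammaSeq b k)⁻¹ * (GammaSeq c k * GammaSeq d k)) Filter.atTop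
      (nhds ((Gamma a)⁻¹ * (Gamma b)⁻¹ * (Gamma c * Gamma d))) :=
    (((GammaSeq_tendsto_Gamma a).inv₀ (Gamma_ne_zero ha)).mul
      ((GammaSeq_tendsto_Gamma b).inv₀ (Gamma_ne_zero hb))).mul
      ((GammaSeq_tendsto_Gamma c).mul (GammaSeq_tendsto_Gamma d))
  have h2 : (fun k : ℕ => (k : ℂ) ^ (a + b - c - d)) =O[Filter.atTop]
      fun k : ℕ => (k : ℝ) ^ (a + b - c - d).re := by
    refine Asymptotics.IsBigO.of_bound 1 ?_
    filter_upwards [Filter.eventually_gt_atTop 0] with k hk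
    rw [norm_natCast_cpow_of_pos hk, one_mul]
    exact le_abs_self _
  refine ((h2.mul (h1.isBigO_one ℝ)).congr' ?_ ?_)
  · filter_upwards [Filter.eventually_ne_atTop 0] with k hk
    have hk' : (k : ℂ) ≠ 0 := by exact_mod_cast hk
    have hf : (k.factorial : ℂ) ≠ 0 := by exact_mod_cast k.factorial_ne_zero
    have hp : ∀ x : ℂ, (k : ℂ) ^ x ≠ 0 := fun x => by simp [cpow_eq_zero_iff, hk]
    rw [hgCoeff, rf_succ_eq_GammaSeq a hk, rf_succ_eq_GammaSeq b hk, rf_succ_eq_GammaSeq c hk,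
      rf_succ_eq_GammaSeq d hk, cpow_sub _ _ hk', cpow_sub _ _ hk', cpow_add _ _ hk']
    have hc := hp c
    have hd := hp d
    simp only [div_eq_mul_inv, mul_inv, inv_inv]
    field_simp
  · simp

theorem summable_hgCoeff_mul {a b c d : ℂ} (ha : ∀ m : ℕ, a ≠ -m) (hb : ∀ m : ℕ, b ≠ -m)
    (h : 1 < (c + d - a - b).re) {D : ℕ → ℂ} {B : ℝ} (hD : ∀ k, ‖D k‖ ≤ B) :
    Summable fun k => hgCoeff a b c d k * D k := by
  rw [← summable_nat_add_iff 1]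
  have h1 : (fun k => D (k + 1)) =O[Filter.atTop] fun _ => (1 : ℝ) :=
    Asymptotics.IsBigO.of_bound B (Filter.Eventually.of_forall fun k => by simpa using hD (k + 1))
  have h2 := (hgCoeff_succ_isBigO ha hb c d).mul h1
  simp only [mul_one] at h2
  refine summable_of_isBigO_nat (Real.summable_nat_rpow.mpr ?_) h2
  simp at h ⊢
  linarith

theorem summable_hgCoeff {a b c d : ℂ} (ha : ∀ m : ℕ, a ≠ -m) (hb : ∀ m : ℕ, b ≠ -m)
    (h : 1 < (c + d - a - b).re) : Summable (hgCoeff a b c d) := by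
  simpa using summable_hgCoeff_mul ha hb h (D := fun _ => 1) (B := 1) (by simp)

theorem tendsto_mul_hgCoeff_mul {a b c d : ℂ} (ha : ∀ m : ℕ, a ≠ -m) (hb : ∀ m : ℕ, b ≠ -m)
    (h : 1 < (c + d - a - b).re) {D : ℕ → ℂ} {B : ℝ} (hD : ∀ k, ‖D k‖ ≤ B) :
    Filter.Tendsto (fun k : ℕ => (k : ℂ) * (hgCoeff a b c d k * D k)) Filter.atTop (nhds 0) := by
  rw [← Filter.tendsto_add_atTop_iff_nat 1]
  have h1 : (fun k => D (k + 1)) =O[Filter.atTop] fun _ => (1 : ℝ) :=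
    Asymptotics.IsBigO.of_bound B (Filter.Eventually.of_forall fun k => by simpa using hD (k + 1))
  have h3 : (fun k : ℕ => ((k + 1 : ℕ) : ℂ)) =O[Filter.atTop] fun k : ℕ => (k : ℝ) := by
    refine Asymptotics.IsBigO.of_bound 2 ?_
    filter_upwards [Filter.eventually_ge_atTop 1] with k hk
    have : (1 : ℝ) ≤ k := by exact_mod_cast hk
    rw [norm_natCast, Real.norm_natCast]
    push_cast
    linarith
  have h2 := h3.mul ((hgCoeff_succ_isBigO ha hb c d).mul h1)
  refine h2.trans_tendsto ?_
  have h4 : Filter.Tendsto (fun k : ℕ => (k : ℝ) ^ (-((c + d - a - b).re - 1))) Filter.atTop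
      (nhds 0) := (tendsto_rpow_neg_atTop (by linarith)).comp tendsto_natCast_atTop_atTop
  refine h4.congr' ?_
  filter_upwards [Filter.eventually_gt_atTop 0] with k hk
  have : (0 : ℝ) < k := by exact_mod_cast hk
  rw [mul_one]
  nth_rewrite 2 [← Real.rpow_one (k : ℝ)]
  rw [← Real.rpow_add this]
  congr 1
  simp
  ring

theorem tsum_sub_succ_of_tendsto_zero {u : ℕ → ℂ} (hu : Filter.Tendsto u Filter.atTop (nhds 0))
    (hs : Summable fun k => u k - u (k + 1)) : ∑' k, (u k - u (k + 1)) = u 0 := by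
  refine tendsto_nhds_unique hs.hasSum.tendsto_sum_nat ?_
  simp only [sum_range_sub']
  simpa using hu.const_sub (u 0)

theorem tsum_hgCoeff_contiguous {a b c : ℂ} (ha : ∀ m : ℕ, a ≠ -m) (hb : ∀ m : ℕ, b ≠ -m)
    (hc : ∀ m : ℕ, c ≠ -m) (h : 0 < (c - a - b).re) :
    c * (c - a - b) * ∑' k, hgCoeff a b c 1 k =
      (c - a) * (c - b) * ∑' k, hgCoeff a b (c + 1) 1 k := by
  have h1 : 1 < (c + 1 - a - b).re := by simp at h ⊢; linarith
  have h2 : 1 < (c + 1 + 1 - a - b).re := by simp at h ⊢; linarith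
  have s1 := summable_hgCoeff ha hb h1
  have s2 := summable_hgCoeff ha hb h2
  have hc0 : c ≠ 0 := by simpa using hc 0
  have hshift : ∀ k : ℕ, (c + k) * hgCoeff a b (c + 1) 1 k = c * hgCoeff a b c 1 k := by
    intro k
    have e : c * rf (c + 1) k = rf c k * (c + k) := by rw [← rf_succ_left, rf_succ]
    have n1 : rf c k ≠ 0 := rf_ne_zero hc k
    have n2 : c + k ≠ 0 := fun h => hc k (eq_neg_of_add_eq_zero_left h)
    have n3 : rf (c + 1) k ≠ 0 := fun h0 => by
      rw [h0, mul_zero] at e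
      exact mul_ne_zero n1 n2 e.symm
    have n4 : rf 1 k ≠ 0 := by rw [rf_one]; exact_mod_cast k.factorial_ne_zero
    unfold hgCoeff
    field_simp
    linear_combination -(rf a k * rf b k) * e
  have hterm : ∀ k : ℕ, c * (c - a - b) * hgCoeff a b c 1 k -
      (c - a) * (c - b) * hgCoeff a b (c + 1) 1 k =
      c * ((k : ℂ) * hgCoeff a b c 1 k) - c * (((k + 1 : ℕ) : ℂ) * hgCoeff a b c 1 (k + 1)) := by
    intro k
    have n1 : c + k ≠ 0 := fun h => hc k (eq_neg_of_add_eq_zero_left h)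
    have n2 : (1 : ℂ) + k ≠ 0 := by rw [add_comm]; exact_mod_cast k.succ_ne_zero
    have e1 : ((k + 1 : ℕ) : ℂ) * hgCoeff a b c 1 (k + 1) =
        hgCoeff a b c 1 k * ((a + k) * (b + k)) / (c + k) := by
      rw [hgCoeff_succ]
      push_cast
      field_simp
      ring
    have e2 : hgCoeff a b (c + 1) 1 k = c * hgCoeff a b c 1 k / (c + k) := by
      rw [eq_div_iff n1, ← hshift k]
      ring
    rw [e1, e2]
    field_simp
    ring
  have hlim : Filter.Tendsto (fun k : ℕ => c * ((k : ℂ) * hgCoeff a b c 1 k)) Filter.atTop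
      (nhds 0) := by
    simpa using (tendsto_mul_hgCoeff_mul ha hb h1 (D := fun _ => 1) (B := 1) (by simp)).const_mul c
  have hs := (s1.mul_left (c * (c - a - b))).sub (s2.mul_left ((c - a) * (c - b)))
  have h5 := tsum_sub_succ_of_tendsto_zero hlim (hs.congr hterm)
  rw [← tsum_congr hterm, (s1.mul_left _).tsum_sub (s2.mul_left _), tsum_mul_left,
    tsum_mul_left] at h5
  simp only [CharP.cast_eq_zero, zero_mul, mul_zero] at h5
  exact sub_eq_zero.mp h5

theorem tendsto_inv_rf_add_natCast (c : ℂ) (k : ℕ) :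
    Filter.Tendsto (fun n : ℕ => (rf (c + n) (k + 1))⁻¹) Filter.atTop (nhds 0) := by
  have h : ∀ x : ℂ, Filter.Tendsto (fun n : ℕ => (x + n)⁻¹) Filter.atTop (nhds 0) := fun x =>
    Filter.tendsto_inv₀_cobounded.comp
      ((_root_.tendsto_const_add_cobounded x).comp tendsto_natCast_atTop_cobounded)
  induction k with
  | zero => simpa [rf] using h c
  | succ k ih =>
    have := ih.mul (h (c + (k + 1 : ℕ)))
    rw [mul_zero] at this
    refine this.congr fun n => ?_
    rw [rf_succ _ (k + 1), mul_inv]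
    ring_nf

theorem norm_rf_le (a : ℂ) {A : ℝ} (h : ‖a‖ ≤ A) (k : ℕ) : ‖rf a k‖ ≤ ‖rf (A : ℂ) k‖ := by
  unfold rf
  rw [norm_prod, norm_prod]
  refine prod_le_prod (fun _ _ => norm_nonneg _) fun j _ => ?_
  have h1 : ((A : ℂ) + j) = ((A + j : ℝ) : ℂ) := by push_cast; rfl
  have := (norm_nonneg a).trans h
  rw [h1, norm_real, Real.norm_of_nonneg (by positivity)]
  refine (norm_add_le _ _).trans ?_
  simpa using h

theorem norm_rf_ge (c : ℂ) {R : ℝ} (hR : 0 ≤ R) (h : R ≤ c.re) (k : ℕ) :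
    ‖rf (R : ℂ) k‖ ≤ ‖rf c k‖ := by
  unfold rf
  rw [norm_prod, norm_prod]
  refine prod_le_prod (fun _ _ => norm_nonneg _) fun j _ => ?_
  have h1 : ((R : ℂ) + j) = ((R + j : ℝ) : ℂ) := by push_cast; rfl
  rw [h1, norm_real, Real.norm_of_nonneg (by positivity)]
  refine le_trans ?_ (re_le_norm _)
  simpa using h

theorem ofReal_ne_neg_natCast {x : ℝ} (hx : 0 < x) (m : ℕ) : (x : ℂ) ≠ -m := by
  intro h
  have h1 := congrArg re h
  simp only [ofReal_re, neg_re, natCast_re] at h1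
  have : (0 : ℝ) ≤ m := by positivity
  linarith

theorem tendsto_tsum_hgCoeff_add_natCast (a b c : ℂ) :
    Filter.Tendsto (fun n : ℕ => ∑' k, hgCoeff a b (c + n) 1 k) Filter.atTop (nhds 1) := by
  set A : ℝ := ‖a‖ + 1
  set B : ℝ := ‖b‖ + 1
  have hA : 0 < A := by positivity
  have hB : 0 < B := by positivity
  have hsum : Summable fun k => ‖hgCoeff A B (A + B + 1 : ℝ) 1 k‖ :=
    (summable_hgCoeff (ofReal_ne_neg_natCast hA) (ofReal_ne_neg_natCast hB) (by
      push_cast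
      simp
      linarith)).norm
  have h1 : ∑' k : ℕ, (if k = 0 then (1 : ℂ) else 0) = 1 := tsum_ite_eq 0 _
  suffices Filter.Tendsto (fun n : ℕ => ∑' k, hgCoeff a b (c + n) 1 k) Filter.atTop
      (nhds (∑' k : ℕ, if k = 0 then (1 : ℂ) else 0)) by rwa [h1] at this
  refine tendsto_tsum_of_dominated_convergence hsum (fun k => ?_) ?_
  · cases k with
    | zero => simp [hgCoeff, rf_zero]
    | succ k =>
      simp only [Nat.succ_ne_zero, if_false]
      have := (tendsto_inv_rf_add_natCast c k).const_mul
        (rf a (k + 1) * rf b (k + 1) * (rf 1 (k + 1))⁻¹)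
      rw [mul_zero] at this
      refine this.congr fun n => ?_
      rw [hgCoeff, div_eq_mul_inv, mul_inv]
      ring
  · obtain ⟨n₀, hn₀⟩ := exists_nat_ge (A + B + 1 - c.re)
    filter_upwards [Filter.eventually_ge_atTop n₀] with n hn k
    have hn' : (n₀ : ℝ) ≤ n := by exact_mod_cast hn
    have hR : 0 < A + B + 1 := by positivity
    have h2 := norm_rf_ge (c + n) hR.le (by simp; linarith) k
    have h3 : 0 < ‖rf ((A + B + 1 : ℝ) : ℂ) k‖ :=
      norm_pos_iff.mpr (rf_ne_zero (ofReal_ne_neg_natCast hR) k)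
    have h4 : 0 < ‖rf 1 k‖ := by
      rw [rf_one, Complex.norm_natCast]
      exact_mod_cast k.factorial_pos
    unfold hgCoeff
    rw [norm_div, norm_div, norm_mul, norm_mul, norm_mul, norm_mul]
    gcongr
    · exact norm_rf_le a (by simp [A]) k
    · exact norm_rf_le b (by simp [B]) k

/-- The Gauss summation theorem. -/
theorem tsum_hgCoeff_eq_Gamma {a b c : ℂ} (ha : ∀ m : ℕ, a ≠ -m) (hb : ∀ m : ℕ, b ≠ -m)
    (hc : ∀ m : ℕ, c ≠ -m) (h : 0 < (c - a - b).re) :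
    ∑' k, hgCoeff a b c 1 k =
      Gamma c * Gamma (c - a - b) / (Gamma (c - a) * Gamma (c - b)) := by
  have hrec : ∀ n : ℕ, rf c n * rf (c - a - b) n * ∑' k, hgCoeff a b c 1 k =
      rf (c - a) n * rf (c - b) n * ∑' k, hgCoeff a b (c + n) 1 k := by
    intro n
    induction n with
    | zero => simp [rf_zero]
    | succ n ih =>
      have h1 := tsum_hgCoeff_contiguous (c := c + n) ha hb
        (fun m hm => hc (n + m) (by push_cast; linear_combination hm))
        (by simp at h ⊢; have : (0 : ℝ) ≤ n := by positivity
            linarith)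
      have e : c + ((n + 1 : ℕ) : ℂ) = c + n + 1 := by push_cast; ring
      rw [e]
      simp only [rf_succ]
      linear_combination (c + n) * (c - a - b + n) * ih + rf (c - a) n * rf (c - b) n * h1
  have hL : Filter.Tendsto (fun n => (GammaSeq c n)⁻¹ * (GammaSeq (c - a - b) n)⁻¹ *
      ∑' k, hgCoeff a b c 1 k) Filter.atTop
      (nhds ((Gamma c)⁻¹ * (Gamma (c - a - b))⁻¹ * ∑' k, hgCoeff a b c 1 k)) :=
    ((tendsto_inv_GammaSeq _).mul (tendsto_inv_GammaSeq _)).mul_const _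
  have hR : Filter.Tendsto (fun n => (GammaSeq (c - a) n)⁻¹ * (GammaSeq (c - b) n)⁻¹ *
      ∑' k, hgCoeff a b (c + (n + 1 : ℕ)) 1 k) Filter.atTop
      (nhds ((Gamma (c - a))⁻¹ * (Gamma (c - b))⁻¹ * 1)) :=
    ((tendsto_inv_GammaSeq _).mul (tendsto_inv_GammaSeq _)).mul
      ((tendsto_tsum_hgCoeff_add_natCast a b c).comp (Filter.tendsto_add_atTop_nat 1))
  have heq := tendsto_nhds_unique (hL.congr' (by
    filter_upwards [Filter.eventually_ne_atTop 0] with n hn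
    have hn' : (n : ℂ) ≠ 0 := by exact_mod_cast hn
    have h1 := hrec (n + 1)
    simp only [rf_succ_eq_GammaSeq _ hn] at h1
    have hf : (n.factorial : ℂ) ≠ 0 := by exact_mod_cast n.factorial_ne_zero
    have hp : (n : ℂ) ^ (c + (c - a - b)) ≠ 0 := by simp [cpow_eq_zero_iff, hn]
    have e1 : (n : ℂ) ^ c * (n : ℂ) ^ (c - a - b) = (n : ℂ) ^ (c + (c - a - b)) :=
      (cpow_add _ _ hn').symm
    have e2 : (n : ℂ) ^ (c - a) * (n : ℂ) ^ (c - b) = (n : ℂ) ^ (c + (c - a - b)) := by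
      rw [← cpow_add _ _ hn']
      ring_nf
    refine mul_left_cancel₀ (mul_ne_zero hp (mul_ne_zero hf hf)) ?_
    nth_rewrite 1 [← e1]
    rw [← e2]
    linear_combination h1)) hR
  have g1 : Gamma c ≠ 0 := Gamma_ne_zero hc
  have g2 : Gamma (c - a - b) ≠ 0 := Gamma_ne_zero_of_re_pos h
  rw [mul_one] at heq
  calc ∑' k, hgCoeff a b c 1 k = Gamma c * Gamma (c - a - b) *
      ((Gamma c)⁻¹ * (Gamma (c - a - b))⁻¹ * ∑' k, hgCoeff a b c 1 k) := by field_simp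
    _ = _ := by rw [heq, div_eq_mul_inv, mul_inv]

theorem ne_neg_natCast_of_ne_intCast {x : ℂ} (hx : ∀ n : ℤ, x ≠ n) (m : ℕ) : x ≠ -m :=
  fun h => hx (-m) (by push_cast; exact h)

theorem add_natCast_ne_neg_natCast {x : ℂ} (hx : ∀ m : ℕ, x ≠ -m) (k m : ℕ) : x + k ≠ -m :=
  fun h => hx (k + m) (by push_cast; linear_combination h)

theorem one_ne_neg_natCast (m : ℕ) : (1 : ℂ) ≠ -m := by
  simpa using ofReal_ne_neg_natCast one_pos m

theorem ψ_add_one {z : ℂ} (hz : ∀ m : ℕ, z ≠ -m) : ψ (z + 1) = ψ z + z⁻¹ :=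
  digamma_apply_add_one z hz

theorem ψ_add_natCast {z : ℂ} (hz : ∀ m : ℕ, z ≠ -m) (k : ℕ) :
    ψ (z + k) = ψ z + ∑ j ∈ range k, (z + j)⁻¹ := by
  induction k with
  | zero => simp
  | succ k ih =>
    rw [sum_range_succ, ← add_assoc, ← ih, ← ψ_add_one (add_natCast_ne_neg_natCast hz k)]
    push_cast
    ring_nf

theorem exists_norm_ψ_sub_ψ_le {x y : ℂ} (hx : ∀ m : ℕ, x ≠ -m) (hy : ∀ m : ℕ, y ≠ -m) :
    ∃ B, ∀ k : ℕ, ‖ψ (x + k) - ψ (y + k)‖ ≤ B := by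
  have hx0 : x ≠ 0 := by simpa using hx 0
  have hy0 : y ≠ 0 := by simpa using hy 0
  have hs : Summable fun j : ℕ => (x + j)⁻¹ - (y + j)⁻¹ := by
    refine ((summable_hgCoeff (a := x) (b := y) (c := x + 1) (d := y + 1) hx hy (by
      ring_nf; simp)).mul_left ((y - x) / (x * y))).congr fun j => ?_
    have n1 : x + j ≠ 0 := fun h => hx j (eq_neg_of_add_eq_zero_left h)
    have n2 : y + j ≠ 0 := fun h => hy j (eq_neg_of_add_eq_zero_left h)
    have e1 : rf (x + 1) j = rf x j * (x + j) / x := by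
      rw [← rf_succ, rf_succ_left]; field_simp
    have e2 : rf (y + 1) j = rf y j * (y + j) / y := by
      rw [← rf_succ, rf_succ_left]; field_simp
    have n3 := rf_ne_zero hx j
    have n4 := rf_ne_zero hy j
    rw [hgCoeff, e1, e2]
    field_simp
    ring
  refine ⟨‖ψ x - ψ y‖ + ∑' j : ℕ, ‖(x + j)⁻¹ - (y + j)⁻¹‖, fun k => ?_⟩
  rw [ψ_add_natCast hx, ψ_add_natCast hy, add_sub_add_comm, ← sum_sub_distrib]
  refine (norm_add_le _ _).trans ?_
  gcongr
  exact (norm_sum_le _ _).trans (hs.norm.sum_le_tsum _ fun _ _ => norm_nonneg _)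

theorem sin_pi_mul_ne_zero_of_ne_intCast {z : ℂ} (hz : ∀ n : ℤ, z ≠ n) : sin (Real.pi * z) ≠ 0 := by
  intro h
  obtain ⟨k, hk⟩ := sin_eq_zero_iff.mp h
  have hpi : (Real.pi : ℂ) ≠ 0 := by exact_mod_cast Real.pi_ne_zero
  exact hz k (mul_left_cancel₀ hpi (by rw [hk, mul_comm]))

theorem one_sub_ne_intCast {z : ℂ} (hz : ∀ n : ℤ, z ≠ n) (n : ℤ) : 1 - z ≠ n :=
  fun h => hz (1 - n) (by push_cast; linear_combination -h)

theorem ψ_one_sub {z : ℂ} (hz : ∀ n : ℤ, z ≠ n) :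
    ψ (1 - z) = ψ z + Real.pi * cot (Real.pi * z) := by
  have h1 := ne_neg_natCast_of_ne_intCast hz
  have h2 := ne_neg_natCast_of_ne_intCast (one_sub_ne_intCast hz)
  have hsin := sin_pi_mul_ne_zero_of_ne_intCast hz
  have d1 := (differentiableAt_Gamma z h1).hasDerivAt
  have d2 := (differentiableAt_Gamma (1 - z) h2).hasDerivAt.comp_const_sub 1 z
  have d3 : HasDerivAt (fun z : ℂ => sin (Real.pi * z)) (cos (Real.pi * z) * Real.pi) z := by
    simpa using ((hasDerivAt_id z).const_mul (Real.pi : ℂ)).csin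
  have d4 := (hasDerivAt_const z (Real.pi : ℂ)).div d3 hsin
  have d5 := (d1.mul d2).congr_of_eventuallyEq (f₁ := fun z => (Real.pi : ℂ) / sin (Real.pi * z))
    (Filter.Eventually.of_forall fun w => (Gamma_mul_Gamma_one_sub w).symm)
  have h3 := d5.unique d4
  have g1 := Gamma_ne_zero h1
  have g2 := Gamma_ne_zero h2
  have hG := Gamma_mul_Gamma_one_sub z
  rw [eq_div_iff hsin] at hG
  simp only [zero_mul, zero_sub] at h3
  rw [eq_div_iff (pow_ne_zero 2 hsin)] at h3
  unfold ψ
  rw [cot]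
  generalize sin (Real.pi * z) = S at *
  generalize cos (Real.pi * z) = C at *
  field_simp
  refine mul_right_cancel₀ hsin ?_
  linear_combination -h3 - C * Real.pi * hG

theorem cot_pi_mul_add_natCast (z : ℂ) (k : ℕ) :
    cot (Real.pi * (z + k)) = cot (Real.pi * z) := by
  have : (Real.pi : ℂ) * (z + k) = Real.pi * z + k * Real.pi := by ring
  rw [this, ← tan_inv_eq_cot, ← tan_inv_eq_cot, tan_add_nat_mul_pi]

theorem hasDerivAt_invBeta {a c s : ℂ} (h1 : ∀ m : ℕ, 1 - a - s ≠ -m) (h2 : ∀ m : ℕ, c + s ≠ -m) :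
    HasDerivAt (invBeta a c) (invBeta a c s * (ψ (1 - a - s) - ψ (c + s))) s := by
  have d1 := ((differentiableAt_Gamma _ h1).hasDerivAt.comp_const_sub (1 - a) s).inv
    (Gamma_ne_zero h1)
  have d2 := ((differentiableAt_Gamma _ h2).hasDerivAt.comp_const_add c s).inv (Gamma_ne_zero h2)
  have g1 := Gamma_ne_zero h1
  have g2 := Gamma_ne_zero h2
  refine (d1.mul d2).congr_deriv ?_
  simp only [invBeta, ψ, Pi.inv_apply]
  field_simp
  ring

theorem invBeta_add_one (a c s : ℂ) :
    invBeta a c (s + 1) = -(a + s) * invBeta a (c + 1) s := by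
  unfold invBeta
  rw [one_div_Gamma_eq_self_mul_one_div_Gamma_add_one (1 - a - (s + 1))]
  ring_nf

theorem bilateralTerm_add_one (a b c s : ℂ) :
    (c + s) * (1 + s) * bilateralTerm a b c (s + 1) =
      (a + s) * (b + s) * bilateralTerm a b c s := by
  unfold bilateralTerm
  linear_combination (1 + s) * invBeta b 1 (s + 1) * mul_invBeta_add_one a c s -
    (a + s) * invBeta a c s * mul_invBeta_add_one b 1 s

theorem bilateralTerm_contiguous (a b c s : ℂ) :
    (c - a - b) * bilateralTerm a b c s - (c - a) * (c - b) * bilateralTerm a b (c + 1) s =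
      s * bilateralTerm a b c s - (s + 1) * bilateralTerm a b c (s + 1) := by
  have h1 := mul_invBeta_add_one b 1 s
  unfold bilateralTerm
  rw [invBeta_add_one a c s, invBeta_eq_mul_invBeta_add_one_right a c s]
  linear_combination (a + s) * invBeta a (c + 1) s * (-h1)

theorem hasDerivAt_bilateralTerm (a b c s : ℂ) :
    HasDerivAt (bilateralTerm a b c) (deriv (bilateralTerm a b c) s) s :=
  (differentiable_bilateralTerm a b c s).hasDerivAt

theorem hasDerivAt_bilateralTerm_add_one (a b c s : ℂ) :
    HasDerivAt (fun z => bilateralTerm a b c (z + 1)) (deriv (bilateralTerm a b c) (s + 1)) s :=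
  (hasDerivAt_bilateralTerm a b c (s + 1)).comp_add_const s 1

theorem deriv_bilateralTerm_add_one (a b c s : ℂ) :
    (c + s + (1 + s)) * bilateralTerm a b c (s + 1) +
      (c + s) * (1 + s) * deriv (bilateralTerm a b c) (s + 1) =
    (a + s + (b + s)) * bilateralTerm a b c s +
      (a + s) * (b + s) * deriv (bilateralTerm a b c) s := by
  have lin : ∀ x : ℂ, HasDerivAt (fun z => x + z) 1 s := fun x => (hasDerivAt_id s).const_add x
  have d1 := ((lin c).mul (lin 1)).mul (hasDerivAt_bilateralTerm_add_one a b c s)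
  have d2 := ((lin a).mul (lin b)).mul (hasDerivAt_bilateralTerm a b c s)
  have h := (d1.congr_of_eventuallyEq
    (Filter.Eventually.of_forall fun z => (bilateralTerm_add_one a b c z).symm)).unique d2
  simp only [Pi.mul_apply] at h
  linear_combination h

theorem deriv_bilateralTerm_contiguous (a b c s : ℂ) :
    (c - a - b) * deriv (bilateralTerm a b c) s -
      (c - a) * (c - b) * deriv (bilateralTerm a b (c + 1)) s =
    (bilateralTerm a b c s + s * deriv (bilateralTerm a b c) s) -
      (bilateralTerm a b c (s + 1) + (s + 1) * deriv (bilateralTerm a b c) (s + 1)) := by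
  have d1 := ((hasDerivAt_bilateralTerm a b c s).const_mul (c - a - b)).sub
    ((hasDerivAt_bilateralTerm a b (c + 1) s).const_mul ((c - a) * (c - b)))
  have d2 := ((hasDerivAt_id s).mul (hasDerivAt_bilateralTerm a b c s)).sub
    (((hasDerivAt_id s).add_const 1).mul (hasDerivAt_bilateralTerm_add_one a b c s))
  have h := (d1.congr_of_eventuallyEq
    (Filter.Eventually.of_forall fun z => (bilateralTerm_contiguous a b c z).symm)).unique d2
  simp only [id] at h
  linear_combination h

theorem bilateralTerm_neg_natCast_add_one (a b c : ℂ) (n : ℕ) :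
    bilateralTerm a b c (-(n + 1)) = 0 := by
  simp [bilateralTerm, invBeta, Gamma_neg_nat_eq_zero]

theorem bilateralTerm_natCast {c : ℂ} (hc : ∀ m : ℕ, c ≠ -m) (a b : ℂ) (k : ℕ) :
    bilateralTerm a b c k = bilateralTerm a b c 0 * hgCoeff a b c 1 k := by
  induction k with
  | zero => simp [hgCoeff, rf_zero]
  | succ k ih =>
    have n1 : c + k ≠ 0 := fun h => hc k (eq_neg_of_add_eq_zero_left h)
    have n2 : (1 : ℂ) + k ≠ 0 := by rw [add_comm]; exact_mod_cast k.succ_ne_zero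
    have h := bilateralTerm_add_one a b c k
    rw [hgCoeff_succ, ← mul_assoc, ← ih]
    push_cast
    field_simp
    linear_combination h

theorem deriv_bilateralTerm_natCast {a b c : ℂ} (ha : ∀ n : ℤ, a ≠ n) (hb : ∀ n : ℤ, b ≠ n)
    (hc : ∀ m : ℕ, c ≠ -m) (k : ℕ) :
    deriv (bilateralTerm a b c) k = bilateralTerm a b c 0 * (hgCoeff a b c 1 k *
      (Real.pi * (cot (Real.pi * a) + cot (Real.pi * b)) -
        (ψ (c + k) + ψ (1 + k) - ψ (a + k) - ψ (b + k)))) := by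
  have hadd : ∀ {x : ℂ}, (∀ n : ℤ, x ≠ n) → ∀ n : ℤ, x + k ≠ n := fun hx n h =>
    hx (n - k) (by push_cast; linear_combination h)
  have hsub : ∀ {x : ℂ}, (∀ n : ℤ, x ≠ n) → ∀ m : ℕ, 1 - x - k ≠ -m := fun {x} hx m => by
    rw [sub_sub]
    exact ne_neg_natCast_of_ne_intCast (one_sub_ne_intCast (hadd hx)) m
  have hψ : ∀ {x : ℂ}, (∀ n : ℤ, x ≠ n) →
      ψ (1 - x - k) = ψ (x + k) + Real.pi * cot (Real.pi * x) := fun {x} hx => by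
    rw [sub_sub, ψ_one_sub (hadd hx), cot_pi_mul_add_natCast]
  have d := (hasDerivAt_invBeta (hsub ha) (add_natCast_ne_neg_natCast hc k)).mul
    (hasDerivAt_invBeta (hsub hb) (add_natCast_ne_neg_natCast one_ne_neg_natCast k))
  have h := (hasDerivAt_bilateralTerm a b c k).unique d
  rw [h, ← mul_assoc (bilateralTerm a b c 0), ← bilateralTerm_natCast hc, hψ ha, hψ hb,
    bilateralTerm]
  ring

theorem deriv_bilateralTerm_neg_natCast_add_one {a b : ℂ} (ha : ∀ n : ℤ, a ≠ n)
    (hb : ∀ n : ℤ, b ≠ n) (c : ℂ) (n : ℕ) :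
    deriv (bilateralTerm a b c) (-(n + 1)) = -((1 - c) / ((1 - a) * (1 - b))) *
      bilateralTerm a b c 0 * hgCoeff 1 (2 - c) (2 - a) (2 - b) n := by
  have hne : ∀ {x : ℂ}, (∀ n : ℤ, x ≠ n) → ∀ m : ℕ, 2 - x + m ≠ 0 := fun hx m h =>
    hx (2 + m) (by push_cast; linear_combination -h)
  induction n with
  | zero =>
    have n1 : 1 - a ≠ 0 := sub_ne_zero.mpr fun h => ha 1 (by simpa using h.symm)
    have n2 : 1 - b ≠ 0 := sub_ne_zero.mpr fun h => hb 1 (by simpa using h.symm)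
    have h := deriv_bilateralTerm_add_one a b c (-1)
    have h0 := bilateralTerm_neg_natCast_add_one a b c 0
    simp only [Nat.cast_zero, zero_add] at h0 ⊢
    rw [neg_add_cancel, h0] at h
    simp only [hgCoeff, rf_zero]
    field_simp
    linear_combination -h
  | succ n ih =>
    have h := deriv_bilateralTerm_add_one a b c (-((n + 1 : ℕ) + 1))
    have e : -(((n + 1 : ℕ) : ℂ) + 1) + 1 = -(n + 1) := by push_cast; ring
    rw [bilateralTerm_neg_natCast_add_one, e, bilateralTerm_neg_natCast_add_one] at h
    have n1 := hne ha n
    have n2 := hne hb n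
    rw [hgCoeff_succ, ← mul_assoc, ← ih, ← mul_div_assoc, eq_div_iff (mul_ne_zero n1 n2)]
    push_cast at h ⊢
    linear_combination -h

theorem exists_norm_ψ_sum_le {a b c : ℂ} (ha : ∀ m : ℕ, a ≠ -m) (hb : ∀ m : ℕ, b ≠ -m)
    (hc : ∀ m : ℕ, c ≠ -m) :
    ∃ B, ∀ k : ℕ, ‖ψ (c + k) + ψ (1 + k) - ψ (a + k) - ψ (b + k)‖ ≤ B := by
  obtain ⟨B₁, h₁⟩ := exists_norm_ψ_sub_ψ_le hc ha
  obtain ⟨B₂, h₂⟩ := exists_norm_ψ_sub_ψ_le one_ne_neg_natCast hb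
  refine ⟨B₁ + B₂, fun k => ?_⟩
  calc _ = ‖(ψ (c + k) - ψ (a + k)) + (ψ (1 + k) - ψ (b + k))‖ := by ring_nf
    _ ≤ _ := (norm_add_le _ _).trans (add_le_add (h₁ k) (h₂ k))

theorem two_sub_ne_neg_natCast {x : ℂ} (hx : ∀ n : ℤ, x ≠ n) (m : ℕ) : 2 - x ≠ -m :=
  fun h => hx (2 + m) (by push_cast; linear_combination -h)

theorem summable_hgCoeff_mul_ψ {a b c : ℂ} (ha : ∀ n : ℤ, a ≠ n)
    (hb : ∀ n : ℤ, b ≠ n) (hc : ∀ n : ℤ, c ≠ n) (h : 0 < (c - a - b).re) :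
    Summable fun k : ℕ =>
      hgCoeff a b c 1 k * (ψ (c + k) + ψ (1 + k) - ψ (a + k) - ψ (b + k)) := by
  have ha' := ne_neg_natCast_of_ne_intCast ha
  have hb' := ne_neg_natCast_of_ne_intCast hb
  obtain ⟨B, hB⟩ := exists_norm_ψ_sum_le ha' hb' (ne_neg_natCast_of_ne_intCast hc)
  exact summable_hgCoeff_mul ha' hb' (by simp at h ⊢; linarith) hB

theorem tendsto_natCast_mul_deriv_bilateralTerm {a b c : ℂ} (ha : ∀ n : ℤ, a ≠ n)
    (hb : ∀ n : ℤ, b ≠ n) (hc : ∀ n : ℤ, c ≠ n) (h : 0 < (c - a - b).re) :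
    Filter.Tendsto (fun k : ℕ => (k : ℂ) * deriv (bilateralTerm a b c) k) Filter.atTop
      (nhds 0) := by
  have ha' := ne_neg_natCast_of_ne_intCast ha
  have hb' := ne_neg_natCast_of_ne_intCast hb
  have hc' := ne_neg_natCast_of_ne_intCast hc
  obtain ⟨B, hB⟩ := exists_norm_ψ_sum_le ha' hb' hc'
  have hlim := (tendsto_mul_hgCoeff_mul ha' hb' (c := c) (d := 1) (by simp at h ⊢; linarith)
    (D := fun k : ℕ => Real.pi * (cot (Real.pi * a) + cot (Real.pi * b)) -
      (ψ (c + k) + ψ (1 + k) - ψ (a + k) - ψ (b + k)))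
    (fun k => (norm_sub_le _ _).trans (add_le_add_right (hB k) _))).const_mul
    (bilateralTerm a b c 0)
  rw [mul_zero] at hlim
  refine hlim.congr fun k => ?_
  rw [deriv_bilateralTerm_natCast ha hb hc']
  ring

theorem hasSum_deriv_bilateralTerm_natCast {a b c : ℂ} (ha : ∀ n : ℤ, a ≠ n)
    (hb : ∀ n : ℤ, b ≠ n) (hc : ∀ n : ℤ, c ≠ n) (h : 0 < (c - a - b).re) :
    HasSum (fun k : ℕ => deriv (bilateralTerm a b c) k) (bilateralTerm a b c 0 *
      (Real.pi * (cot (Real.pi * a) + cot (Real.pi * b)) *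
        (Gamma c * Gamma (c - a - b) / (Gamma (c - a) * Gamma (c - b))) -
        ∑' k : ℕ, hgCoeff a b c 1 k *
          (ψ (c + k) + ψ (1 + k) - ψ (a + k) - ψ (b + k)))) := by
  have ha' := ne_neg_natCast_of_ne_intCast ha
  have hb' := ne_neg_natCast_of_ne_intCast hb
  have hc' := ne_neg_natCast_of_ne_intCast hc
  have hs := summable_hgCoeff ha' hb' (c := c) (d := 1) (by simp at h ⊢; linarith)
  rw [← tsum_hgCoeff_eq_Gamma ha' hb' hc' h]
  refine (((hs.hasSum.mul_left (Real.pi * (cot (Real.pi * a) + cot (Real.pi * b)))).sub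
    (summable_hgCoeff_mul_ψ ha hb hc h).hasSum).mul_left
    (bilateralTerm a b c 0)).congr_fun fun k => ?_
  rw [deriv_bilateralTerm_natCast ha hb hc']
  ring

theorem summable_hgCoeff_two_sub {a b c : ℂ} (hc : ∀ n : ℤ, c ≠ n) (h : 0 < (c - a - b).re) :
    Summable fun k => hgCoeff 1 (2 - c) (2 - a) (2 - b) k := by
  refine summable_hgCoeff one_ne_neg_natCast (two_sub_ne_neg_natCast hc) ?_
  simp at h ⊢
  linarith

theorem hasSum_deriv_bilateralTerm_neg_natCast_add_one {a b c : ℂ} (ha : ∀ n : ℤ, a ≠ n)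
    (hb : ∀ n : ℤ, b ≠ n) (hc : ∀ n : ℤ, c ≠ n) (h : 0 < (c - a - b).re) :
    HasSum (fun n : ℕ => deriv (bilateralTerm a b c) (-(n + 1)))
      (-((1 - c) / ((1 - a) * (1 - b))) * bilateralTerm a b c 0 *
        ∑' n, hgCoeff 1 (2 - c) (2 - a) (2 - b) n) := by
  simp only [deriv_bilateralTerm_neg_natCast_add_one ha hb]
  exact (summable_hgCoeff_two_sub hc h).hasSum.mul_left _

theorem tendsto_natCast_add_one_mul_deriv_bilateralTerm {a b c : ℂ} (ha : ∀ n : ℤ, a ≠ n)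
    (hb : ∀ n : ℤ, b ≠ n) (hc : ∀ n : ℤ, c ≠ n) (h : 0 < (c - a - b).re) :
    Filter.Tendsto (fun n : ℕ => ((n : ℂ) + 1) * deriv (bilateralTerm a b c) (-(n + 1)))
      Filter.atTop (nhds 0) := by
  have hlim := tendsto_mul_hgCoeff_mul one_ne_neg_natCast (two_sub_ne_neg_natCast hc)
    (c := 2 - a) (d := 2 - b) (by simp at h ⊢; linarith) (D := fun _ => 1) (B := 1) (by simp)
  have hs := (summable_hgCoeff_two_sub hc h).tendsto_atTop_zero
  have := (hlim.add hs).const_mul (-((1 - c) / ((1 - a) * (1 - b))) * bilateralTerm a b c 0)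
  rw [add_zero, mul_zero] at this
  refine this.congr fun n => ?_
  rw [deriv_bilateralTerm_neg_natCast_add_one ha hb]
  ring

theorem tsum_natCast_deriv_bilateralTerm_contiguous {a b c : ℂ} (ha : ∀ n : ℤ, a ≠ n)
    (hb : ∀ n : ℤ, b ≠ n) (hc : ∀ n : ℤ, c ≠ n) (h : 0 < (c - a - b).re) :
    (c - a - b) * ∑' k : ℕ, deriv (bilateralTerm a b c) k -
      (c - a) * (c - b) * ∑' k : ℕ, deriv (bilateralTerm a b (c + 1)) k =
    bilateralTerm a b c 0 := by
  have hc1 : ∀ n : ℤ, c + 1 ≠ n := fun n hn =>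
    hc (n - 1) (by push_cast; linear_combination hn)
  have h1 : 0 < (c + 1 - a - b).re := by simp at h ⊢; linarith
  have s1 := (hasSum_deriv_bilateralTerm_natCast ha hb hc h).summable
  have s2 := (hasSum_deriv_bilateralTerm_natCast ha hb hc1 h1).summable
  have hs := summable_hgCoeff (ne_neg_natCast_of_ne_intCast ha) (ne_neg_natCast_of_ne_intCast hb)
    (c := c) (d := 1) (by simp at h ⊢; linarith)
  have hE : Filter.Tendsto (fun k : ℕ => bilateralTerm a b c k) Filter.atTop (nhds 0) := by
    have := hs.tendsto_atTop_zero.const_mul (bilateralTerm a b c 0)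
    rw [mul_zero] at this
    exact this.congr fun k => (bilateralTerm_natCast (ne_neg_natCast_of_ne_intCast hc) a b k).symm
  have hlim := hE.add (tendsto_natCast_mul_deriv_bilateralTerm ha hb hc h)
  rw [add_zero] at hlim
  have hterm := fun k : ℕ => deriv_bilateralTerm_contiguous a b c k
  simp only [← Nat.cast_add_one] at hterm
  have hsub := (s1.mul_left (c - a - b)).sub (s2.mul_left ((c - a) * (c - b)))
  rw [← tsum_mul_left, ← tsum_mul_left, ← (s1.mul_left _).tsum_sub (s2.mul_left _),
    tsum_congr hterm, tsum_sub_succ_of_tendsto_zero hlim (hsub.congr hterm)]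
  simp

theorem tsum_neg_deriv_bilateralTerm_contiguous {a b c : ℂ} (ha : ∀ n : ℤ, a ≠ n)
    (hb : ∀ n : ℤ, b ≠ n) (hc : ∀ n : ℤ, c ≠ n) (h : 0 < (c - a - b).re) :
    (c - a - b) * ∑' n : ℕ, deriv (bilateralTerm a b c) (-(n + 1)) -
      (c - a) * (c - b) * ∑' n : ℕ, deriv (bilateralTerm a b (c + 1)) (-(n + 1)) =
    -bilateralTerm a b c 0 := by
  have hc1 : ∀ n : ℤ, c + 1 ≠ n := fun n hn =>
    hc (n - 1) (by push_cast; linear_combination hn)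
  have h1 : 0 < (c + 1 - a - b).re := by simp at h ⊢; linarith
  have s1 := (hasSum_deriv_bilateralTerm_neg_natCast_add_one ha hb hc h).summable
  have s2 := (hasSum_deriv_bilateralTerm_neg_natCast_add_one ha hb hc1 h1).summable
  set u : ℕ → ℂ := fun n => (n : ℂ) * deriv (bilateralTerm a b c) (-n) - bilateralTerm a b c (-n)
  have hlim : Filter.Tendsto u Filter.atTop (nhds 0) := by
    rw [← Filter.tendsto_add_atTop_iff_nat 1]
    refine (tendsto_natCast_add_one_mul_deriv_bilateralTerm ha hb hc h).congr fun n => ?_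
    simp only [u, Nat.cast_add_one, bilateralTerm_neg_natCast_add_one, sub_zero]
  have hterm : ∀ n : ℕ, (c - a - b) * deriv (bilateralTerm a b c) (-(n + 1)) -
      (c - a) * (c - b) * deriv (bilateralTerm a b (c + 1)) (-(n + 1)) = u n - u (n + 1) := by
    intro n
    have e : -((n : ℂ) + 1) + 1 = -n := by ring
    rw [deriv_bilateralTerm_contiguous, e]
    simp only [u, Nat.cast_add_one]
    ring
  have hsub := (s1.mul_left (c - a - b)).sub (s2.mul_left ((c - a) * (c - b)))
  rw [← tsum_mul_left, ← tsum_mul_left, ← (s1.mul_left _).tsum_sub (s2.mul_left _),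
    tsum_congr hterm, tsum_sub_succ_of_tendsto_zero hlim (hsub.congr hterm)]
  simp [u]

theorem hasSum_int_deriv_bilateralTerm {a b c : ℂ} (ha : ∀ n : ℤ, a ≠ n)
    (hb : ∀ n : ℤ, b ≠ n) (hc : ∀ n : ℤ, c ≠ n) (h : 0 < (c - a - b).re) :
    HasSum (fun k : ℤ => deriv (bilateralTerm a b c) k)
      (∑' k : ℕ, deriv (bilateralTerm a b c) k +
        ∑' n : ℕ, deriv (bilateralTerm a b c) (-(n + 1))) := by
  refine HasSum.of_nat_of_neg_add_one ?_ ?_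
  · simpa using (hasSum_deriv_bilateralTerm_natCast ha hb hc h).summable.hasSum
  · simpa using (hasSum_deriv_bilateralTerm_neg_natCast_add_one ha hb hc h).summable.hasSum

theorem tsum_int_deriv_bilateralTerm_contiguous {a b c : ℂ} (ha : ∀ n : ℤ, a ≠ n)
    (hb : ∀ n : ℤ, b ≠ n) (hc : ∀ n : ℤ, c ≠ n) (h : 0 < (c - a - b).re) :
    (c - a - b) * ∑' k : ℤ, deriv (bilateralTerm a b c) k =
      (c - a) * (c - b) * ∑' k : ℤ, deriv (bilateralTerm a b (c + 1)) k := by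
  have hc1 : ∀ n : ℤ, c + 1 ≠ n := fun n hn =>
    hc (n - 1) (by push_cast; linear_combination hn)
  have h1 : 0 < (c + 1 - a - b).re := by simp at h ⊢; linarith
  rw [(hasSum_int_deriv_bilateralTerm ha hb hc h).tsum_eq,
    (hasSum_int_deriv_bilateralTerm ha hb hc1 h1).tsum_eq]
  linear_combination tsum_natCast_deriv_bilateralTerm_contiguous ha hb hc h +
    tsum_neg_deriv_bilateralTerm_contiguous ha hb hc h

theorem tsum_int_deriv_bilateralTerm_eq_zero {a b c : ℂ} (ha : ∀ n : ℤ, a ≠ n)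
    (hb : ∀ n : ℤ, b ≠ n) (hc : ∀ n : ℤ, c ≠ n) (h : 0 < (c - a - b).re) :
    ∑' k : ℤ, deriv (bilateralTerm a b c) k = 0 := by
  obtain ⟨N, hN⟩ := exists_nat_gt (-(1 - b).re)
  obtain ⟨n, hn⟩ := exists_nat_gt (N + 3 - (c - a).re)
  suffices ∀ (n : ℕ) (c : ℂ), (∀ m : ℤ, c ≠ m) → 0 < (c - a - b).re →
      (N : ℝ) + 3 - (c - a).re < n → ∑' k : ℤ, deriv (bilateralTerm a b c) k = 0 from
    this n c hc h hn
  clear! n c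
  intro n
  induction n with
  | zero =>
    intro c _ _ hn
    exact (hasSum_deriv_bilateralTerm_of_large (N := N) (by linarith)
      (by push_cast at hn; linarith)).tsum_eq
  | succ n ih =>
    intro c hc h hn
    have hne : c - a - b ≠ 0 := fun h0 => by simp [h0] at h
    refine (mul_eq_zero_iff_left hne).mp ?_
    rw [tsum_int_deriv_bilateralTerm_contiguous ha hb hc h, ih (c + 1), mul_zero]
    · exact fun m hm => hc (m - 1) (by push_cast; linear_combination hm)
    · simp at h ⊢
      linarith
    · push_cast at hn
      simp at hn ⊢
      linarith

theorem bilateralTerm_zero_ne_zero {a b c : ℂ} (ha : ∀ n : ℤ, a ≠ n) (hb : ∀ n : ℤ, b ≠ n)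
    (hc : ∀ n : ℤ, c ≠ n) : bilateralTerm a b c 0 ≠ 0 := by
  have h1 := Gamma_ne_zero (ne_neg_natCast_of_ne_intCast (one_sub_ne_intCast ha))
  have h2 := Gamma_ne_zero (ne_neg_natCast_of_ne_intCast (one_sub_ne_intCast hb))
  have h3 := Gamma_ne_zero (ne_neg_natCast_of_ne_intCast hc)
  simp [bilateralTerm, invBeta, h1, h2, h3]

theorem stmt9 (a b c : ℂ)
    (ha : ∀ n : ℤ, a ≠ n) (hb : ∀ n : ℤ, b ≠ n) (hc : ∀ n : ℤ, c ≠ n)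
    (hre : 0 < (c - a - b).re) :
    Summable (fun k : ℕ => ‖rf a k * rf b k / (rf c k * (Nat.factorial k : ℂ)) *
        (ψ (c + k) + ψ (1 + k) - ψ (a + k) - ψ (b + k))‖) ∧
    Summable (fun k : ℕ => ‖(Nat.factorial k : ℂ) * rf (2 - c) k /
        (rf (2 - a) k * rf (2 - b) k)‖) ∧
    (∑' k : ℕ, rf a k * rf b k / (rf c k * (Nat.factorial k : ℂ)) *
        (ψ (c + k) + ψ (1 + k) - ψ (a + k) - ψ (b + k))) =
      (Real.pi : ℂ) * (Complex.cot ((Real.pi : ℂ) * a) + Complex.cot ((Real.pi : ℂ) * b)) *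
        (Complex.Gamma c * Complex.Gamma (c - a - b) /
          (Complex.Gamma (c - a) * Complex.Gamma (c - b))) -
      ((1 - c) / ((1 - a) * (1 - b))) *
        ∑' k : ℕ, (Nat.factorial k : ℂ) * rf (2 - c) k /
          (rf (2 - a) k * rf (2 - b) k) := by
  have hψ := summable_hgCoeff_mul_ψ ha hb hc hre
  have h2 := summable_hgCoeff_two_sub hc hre
  have hsum := tsum_int_deriv_bilateralTerm_eq_zero ha hb hc hre
  rw [(hasSum_int_deriv_bilateralTerm ha hb hc hre).tsum_eq,
    (hasSum_deriv_bilateralTerm_natCast ha hb hc hre).tsum_eq,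
    (hasSum_deriv_bilateralTerm_neg_natCast_add_one ha hb hc hre).tsum_eq] at hsum
  simp only [hgCoeff, rf_one] at hψ h2 hsum
  refine ⟨hψ.norm, h2.norm, mul_left_cancel₀ (bilateralTerm_zero_ne_zero ha hb hc) ?_⟩
  linear_combination -hsum
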